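/- arXiv:2506.20003 — 3 statements merged into one kernel-verified Lean document; each statement's English description precedes it below -/
import Mathlib

section
/- For every even prime power q ≥ 8 there exists a mixed graph on exactly 4q² − 4 vertices which is a [q/4, q; 6]-mixed graph; that is, the minimum order n[q/4, q; 6] of a [q/4, q; 6]-mixed cage satisfies n[q/4, q; 6] ≤ 4q² − 4. -/
/-- A mixed cycle of length `k`: for `k = 2`, a pair of distinct vertices with arcs
in both directions; for `k ≥ 3`, an injective map `ZMod k → V` in which every
consecutive step is an edge or an arc. -/
def HasMixedCycle {V : Type} (E A : V → V → Prop) (k : ℕ) : Prop :=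
  (k = 2 ∧ ∃ u v : V, u ≠ v ∧ A u v ∧ A v u) ∨
  (3 ≤ k ∧ ∃ f : ZMod k → V, Function.Injective f ∧
    ∀ i, E (f i) (f (i + 1)) ∨ A (f i) (f (i + 1)))

/-- `IsMixedGraph E A` says that `(E, A)` is a mixed graph: `E` is a symmetric
irreflexive edge relation, `A` is an irreflexive arc relation, and no pair of
vertices is related both by an edge and by an arc (in either direction). -/
def IsMixedGraph {V : Type} (E A : V → V → Prop) : Prop :=
  (∀ u v, E u v → E v u) ∧ (∀ v, ¬ E v v) ∧ (∀ v, ¬ A v v) ∧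
  (∀ u v, E u v → ¬ A u v ∧ ¬ A v u)

/-- `IsZRSixMixedGraph z r E A` says that `(E, A)` is a `[z, r; 6]`-mixed graph:
a mixed graph in which every vertex has exactly `z` out-neighbors and `z`
in-neighbors under `A` and exactly `r` neighbors under `E`, and in which the
minimum length of a mixed cycle is exactly `6`. -/
def IsZRSixMixedGraph {V : Type} (z r : ℕ) (E A : V → V → Prop) : Prop :=
  IsMixedGraph E A ∧
  (∀ v, {w | A v w}.ncard = z) ∧
  (∀ v, {w | A w v}.ncard = z) ∧
  (∀ v, {w | E v w}.ncard = r) ∧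
  IsLeast {k : ℕ | HasMixedCycle E A k} 6

namespace MixedCage

variable {F : Type} [Field F]

/-- Nonzero vectors of the plane. -/
abbrev NZ (F : Type) [Field F] : Type := {v : F × F // v ≠ 0}

/-- Vertices: copy, side (point or line), nonzero vector. -/
abbrev Vtx (F : Type) [Field F] : Type := Bool × Bool × NZ F

/-- The standard bilinear form. -/
def dot (v w : F × F) : F := v.1 * w.1 + v.2 * w.2

/-- The scaling factor on each side. -/
def cf (g : Fˣ) (a : Bool) : Fˣ := if a then g⁻¹ else g

/-- Scaling of nonzero vectors. -/
def sc (c : Fˣ) (v : NZ F) : NZ F :=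
  ⟨(c : F) • v.1, smul_ne_zero c.ne_zero v.2⟩

/-- Edges: incidence inside each copy. -/
def Ed (x y : Vtx F) : Prop :=
  y.1 = x.1 ∧ y.2.1 = !x.2.1 ∧ dot x.2.2.1 y.2.2.1 = 1

/-- Arcs: scaling between the copies. -/
def Ar (g : Fˣ) (z : ℕ) (x y : Vtx F) : Prop :=
  y.1 = !x.1 ∧ y.2.1 = x.2.1 ∧ ∃ s < z, y.2.2 = sc (cf g x.2.1 ^ (s + x.1.toNat)) x.2.2

theorem dot_comm (v w : F × F) : dot v w = dot w v := by
  unfold dot; ring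

theorem dot_sc (c : Fˣ) (v : NZ F) (w : F × F) : dot (sc c v).1 w = c * dot v.1 w := by
  simp [dot, sc]; ring

theorem sc_sc (c d : Fˣ) (v : NZ F) : sc c (sc d v) = sc (c * d) v := by
  apply Subtype.ext; simp [sc, mul_smul]

theorem sc_one (v : NZ F) : sc 1 v = v := by
  apply Subtype.ext; simp [sc]

theorem sc_inj {c d : Fˣ} {v : NZ F} (h : sc c v = sc d v) : c = d := by
  have h1 : (c : F) • v.1 = (d : F) • v.1 := congrArg Subtype.val h
  exact Units.ext (smul_left_injective F v.2 h1)

theorem cf_pow (g : Fˣ) (a : Bool) (n : ℕ) (h : cf g a ^ n = 1) : g ^ n = 1 := by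
  cases a <;> simpa [cf] using h

theorem two_pts {u u' v v' : F × F} (h1 : dot v u = 1) (h2 : dot u v' = 1) (h3 : dot v' u' = 1)
    (h4 : dot u' v = 1) : v = v' ∨ u = u' := by
  obtain ⟨a, b⟩ := u
  obtain ⟨c, d⟩ := u'
  obtain ⟨x, y⟩ := v
  obtain ⟨x', y'⟩ := v'
  simp only [dot] at h1 h2 h3 h4
  by_cases hd : x * y' = x' * y
  · left
    have e1 : x = x' := by linear_combination (-x) * h2 + b * hd + x' * h1
    have e2 : y = y' := by linear_combination (-y) * h2 - a * hd + y' * h1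
    rw [e1, e2]
  · right
    have hd' : x * y' - x' * y ≠ 0 := sub_ne_zero.2 hd
    have e1 : (x * y' - x' * y) * (a - c) = 0 := by
      linear_combination y' * h1 - y' * h4 - y * h2 + y * h3
    have e2 : (x * y' - x' * y) * (b - d) = 0 := by
      linear_combination (-x') * h1 + x' * h4 + x * h2 - x * h3
    rcases mul_eq_zero.1 e1 with h | h
    · exact absurd h hd'
    rcases mul_eq_zero.1 e2 with h' | h'
    · exact absurd h' hd'
    rw [sub_eq_zero.1 h, sub_eq_zero.1 h']

variable {g : Fˣ} {z N : ℕ}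

/-- Two consecutive arcs scale by a small nontrivial power. -/
theorem ar_ar {x y w : Vtx F} (h : Ar g z x y) (h' : Ar g z y w) :
    w.1 = x.1 ∧ w.2.1 = x.2.1 ∧ ∃ n, 1 ≤ n ∧ n + 1 ≤ 2 * z ∧
      w.2.2 = sc (cf g x.2.1 ^ n) x.2.2 := by
  obtain ⟨a1, a2, s, hs, a3⟩ := h
  obtain ⟨b1, b2, t, ht, b3⟩ := h'
  refine ⟨by simp [b1, a1], by rw [b2, a2], (t + y.1.toNat) + (s + x.1.toNat), ?_, ?_, ?_⟩
  · rw [a1]; cases x.1 <;> simp <;> omega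
  · rw [a1]; cases x.1 <;> simp <;> omega
  · rw [b3, a3, sc_sc, a2, ← pow_add]

theorem no_AA (hN : ∀ n, 1 ≤ n → n + 2 ≤ 4 * z → g ^ n ≠ 1) (hz : 1 ≤ z) {x y : Vtx F}
    (h : Ar g z x y) (h' : Ar g z y x) : False := by
  obtain ⟨-, -, n, h1, h2, h3⟩ := ar_ar h h'
  refine hN n h1 (by omega) (cf_pow g x.2.1 n (sc_inj (v := x.2.2) ?_))
  rw [← h3, sc_one]

theorem no_AAAA (hN : ∀ n, 1 ≤ n → n + 2 ≤ 4 * z → g ^ n ≠ 1) {x y w v : Vtx F}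
    (h : Ar g z x y) (h' : Ar g z y w) (k : Ar g z w v) (k' : Ar g z v x) : False := by
  obtain ⟨-, e, n, h1, h2, h3⟩ := ar_ar h h'
  obtain ⟨-, -, m, k1, k2, k3⟩ := ar_ar k k'
  refine hN (m + n) (by omega) (by omega) (cf_pow g x.2.1 _ (sc_inj (v := x.2.2) ?_))
  rw [h3, sc_sc, e, ← pow_add] at k3
  rw [← k3, sc_one]

theorem no_AAEE (hN : ∀ n, 1 ≤ n → n + 2 ≤ 4 * z → g ^ n ≠ 1) (hz : 1 ≤ z) {x y w v : Vtx F}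
    (h : Ar g z x y) (h' : Ar g z y w) (k : Ed w v) (k' : Ed v x) : False := by
  obtain ⟨-, e, n, h1, h2, h3⟩ := ar_ar h h'
  have k1 := k.2.2
  have k2 := k'.2.2
  rw [h3, dot_sc, dot_comm, k2, mul_one] at k1
  exact hN n h1 (by omega) (cf_pow g x.2.1 n (Units.ext (by simpa using k1)))

theorem no_AEAE (hN : ∀ n, 1 ≤ n → n + 2 ≤ 4 * z → g ^ n ≠ 1) (hz : 1 ≤ z) {x y w v : Vtx F}
    (h : Ar g z x y) (h' : Ed y w) (k : Ar g z w v) (k' : Ed v x) : False := by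
  obtain ⟨a1, a2, s, hs, a3⟩ := h
  obtain ⟨b1, b2, t, ht, b3⟩ := k
  obtain ⟨c1, c2, c3⟩ := h'
  obtain ⟨d1, d2, d3⟩ := k'
  rw [b3, dot_sc] at d3
  rw [a3, dot_sc, dot_comm] at c3
  have key : cf g w.2.1 ^ (t + w.1.toNat) = cf g x.2.1 ^ (s + x.1.toNat) := by
    apply Units.ext
    have hne : dot w.2.2.1 x.2.2.1 ≠ 0 := by
      intro h0
      rw [h0, mul_zero] at d3
      exact zero_ne_one d3
    exact mul_right_cancel₀ hne (d3.trans c3.symm)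
  rw [c2, c1, a2, a1] at key
  have key2 : g ^ ((t + (!x.1).toNat) + (s + x.1.toNat)) = 1 := by
    rw [pow_add]
    cases hx : x.2.1
    · rw [hx] at key
      simp only [cf, Bool.not_false, if_true, inv_pow] at key
      rw [inv_eq_iff_eq_inv] at key
      rw [key]
      simp
    · rw [hx] at key
      simp only [cf, Bool.not_true, if_true, inv_pow] at key
      rw [show ((if false = true then g⁻¹ else g) : Fˣ) = g from rfl] at key
      rw [key]
      simp
  refine hN _ ?_ ?_ key2
  · cases x.1 <;> simp <;> omega
  · cases x.1 <;> simp <;> omega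

theorem no_EEEE {x y w v : Vtx F}
    (h : Ed x y) (h' : Ed y w) (k : Ed w v) (k' : Ed v x) (n1 : x ≠ w) (n2 : y ≠ v) : False := by
  obtain ⟨a1, a2, a3⟩ := h
  obtain ⟨b1, b2, b3⟩ := h'
  obtain ⟨c1, c2, c3⟩ := k
  obtain ⟨d1, d2, d3⟩ := k'
  rcases two_pts a3 b3 c3 d3 with e | e
  · exact n1 (Prod.ext (by rw [b1, a1]) (Prod.ext (by simp [b2, a2]) (Subtype.ext e)))
  · exact n2 (Prod.ext (by rw [c1, b1]) (Prod.ext (by simp [c2, b2]) (Subtype.ext e)))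

/-- Parity invariant: every step flips exactly one of the two bits. -/
theorem parity {x y : Vtx F} (h : Ed x y ∨ Ar g z x y) : xor y.1 y.2.1 = !(xor x.1 x.2.1) := by
  rcases h with ⟨h1, h2, -⟩ | ⟨h1, h2, -⟩ <;> rw [h1, h2] <;> cases x.1 <;> cases x.2.1 <;> rfl

theorem no_four (hN : ∀ n, 1 ≤ n → n + 2 ≤ 4 * z → g ^ n ≠ 1) (hz : 1 ≤ z) {x y w v : Vtx F}
    (n1 : x ≠ w) (n2 : y ≠ v)
    (h1 : Ed x y ∨ Ar g z x y) (h2 : Ed y w ∨ Ar g z y w)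
    (h3 : Ed w v ∨ Ar g z w v) (h4 : Ed v x ∨ Ar g z v x) : False := by
  rcases h1 with h1 | h1 <;> rcases h2 with h2 | h2 <;> rcases h3 with h3 | h3 <;>
    rcases h4 with h4 | h4
  · exact no_EEEE h1 h2 h3 h4 n1 n2
  rotate_left 2
  · exact no_AAEE hN hz h3 h4 h1 h2
  rotate_left 1
  · exact no_AEAE hN hz h2 h3 h4 h1
  · exact no_AAEE hN hz h2 h3 h4 h1
  rotate_left 2
  · exact no_AAEE hN hz h4 h1 h2 h3
  · exact no_AEAE hN hz h1 h2 h3 h4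
  rotate_left 1
  · exact no_AAEE hN hz h1 h2 h3 h4
  rotate_left 2
  · exact no_AAAA hN h1 h2 h3 h4
  all_goals
    exfalso
    have e1 := h1.1
    have e2 := h2.1
    have e3 := h3.1
    have e4 := h4.1
    rw [e3, e2, e1] at e4
    revert e4
    cases x.1 <;> simp

theorem pow_inj (hN : ∀ n, 1 ≤ n → n + 2 ≤ 4 * z → g ^ n ≠ 1) (a : Bool) {s t i : ℕ} (hs : s < z)
    (ht : t < z) (h : cf g a ^ (s + i) = cf g a ^ (t + i)) : s = t := by
  rw [pow_add, pow_add] at h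
  have h := mul_right_cancel h
  rcases lt_trichotomy s t with hlt | hlt | hlt
  · obtain ⟨d, rfl⟩ := Nat.exists_eq_add_of_lt hlt
    rw [add_assoc, pow_add] at h
    exact absurd (cf_pow g a _ (left_eq_mul.1 h)) (hN _ (by omega) (by omega))
  · exact hlt
  · obtain ⟨d, rfl⟩ := Nat.exists_eq_add_of_lt hlt
    rw [add_assoc, pow_add] at h
    exact absurd (cf_pow g a _ (mul_eq_left.1 h)) (hN _ (by omega) (by omega))

theorem out_card (hN : ∀ n, 1 ≤ n → n + 2 ≤ 4 * z → g ^ n ≠ 1) (a : Vtx F) : {w | Ar g z a w}.ncard = z := by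
  have : {w | Ar g z a w} = (fun s => ((!a.1, a.2.1, sc (cf g a.2.1 ^ (s + a.1.toNat)) a.2.2) :
      Vtx F)) '' (Finset.range z : Set ℕ) := by
    ext w
    simp only [Set.mem_setOf_eq, Set.mem_image, Finset.coe_range, Set.mem_Iio]
    constructor
    · rintro ⟨h1, h2, s, hs, h3⟩
      exact ⟨s, hs, Prod.ext h1.symm (Prod.ext h2.symm h3.symm)⟩
    · rintro ⟨s, hs, rfl⟩
      exact ⟨rfl, rfl, s, hs, rfl⟩
  rw [this, Set.ncard_image_of_injOn, Set.ncard_coe_finset, Finset.card_range]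
  intro s hs t ht h
  simp only [Finset.coe_range, Set.mem_Iio] at hs ht
  have h2 := sc_inj (congrArg (fun x : Vtx F => x.2.2) h)
  exact pow_inj hN a.2.1 hs ht h2

theorem in_card (hN : ∀ n, 1 ≤ n → n + 2 ≤ 4 * z → g ^ n ≠ 1) (a : Vtx F) : {w | Ar g z w a}.ncard = z := by
  have : {w | Ar g z w a} = (fun s => ((!a.1, a.2.1,
      sc ((cf g a.2.1 ^ (s + (!a.1).toNat))⁻¹) a.2.2) :
      Vtx F)) '' (Finset.range z : Set ℕ) := by
    ext w
    simp only [Set.mem_setOf_eq, Set.mem_image, Finset.coe_range, Set.mem_Iio]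
    constructor
    · rintro ⟨h1, h2, s, hs, h3⟩
      refine ⟨s, hs, Prod.ext ?_ (Prod.ext h2 ?_)⟩
      · simp [h1]
      · simp only [h3, h2, h1, Bool.not_not, sc_sc, inv_mul_cancel, sc_one]
    · rintro ⟨s, hs, rfl⟩
      refine ⟨by simp, rfl, s, hs, ?_⟩
      simp only [sc_sc, mul_inv_cancel, sc_one]
  rw [this, Set.ncard_image_of_injOn, Set.ncard_coe_finset, Finset.card_range]
  intro s hs t ht h
  simp only [Finset.coe_range, Set.mem_Iio] at hs ht
  have h2 := sc_inj (congrArg (fun x : Vtx F => x.2.2) h)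
  exact pow_inj hN a.2.1 hs ht (inv_injective h2)

theorem edge_card [Finite F] (a : Vtx F) : {w | Ed a w}.ncard = Nat.card F := by
  obtain ⟨i, b, ⟨⟨x, y⟩, hv⟩⟩ := a
  have hne : ∀ w : F × F, dot (x, y) w = 1 → w ≠ 0 := by
    rintro w h rfl
    simp [dot] at h
  by_cases hx : x = 0
  · have hy : y ≠ 0 := by
      rintro rfl
      exact hv (by rw [hx]; rfl)
    have hd : ∀ t : F, dot (x, y) (t, (1 - x * t) / y) = 1 := by
      intro t
      simp only [dot]
      field_simp
      ring
    have : {w : Vtx F | Ed (i, b, ⟨(x, y), hv⟩) w} = Set.range (fun t : F =>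
        ((i, !b, ⟨(t, (1 - x * t) / y), hne _ (hd t)⟩) : Vtx F)) := by
      ext ⟨j, c, ⟨⟨s, t⟩, hw⟩⟩
      simp only [Set.mem_setOf_eq, Set.mem_range]
      constructor
      · rintro ⟨e1, e2, h3⟩
        refine ⟨s, Prod.ext e1.symm (Prod.ext e2.symm (Subtype.ext (Prod.ext rfl ?_)))⟩
        simp only [dot] at h3
        show (1 - x * s) / y = t
        rw [div_eq_iff hy]
        linear_combination -h3
      · rintro ⟨r, hr⟩
        rw [← hr]
        exact ⟨rfl, rfl, hd r⟩
    rw [this, ← Set.image_univ, Set.ncard_image_of_injective, Set.ncard_univ]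
    intro s t h
    exact congrArg (fun x : Vtx F => x.2.2.1.1) h
  · have hd : ∀ t : F, dot (x, y) ((1 - y * t) / x, t) = 1 := by
      intro t
      simp only [dot]
      field_simp
      ring
    have : {w : Vtx F | Ed (i, b, ⟨(x, y), hv⟩) w} = Set.range (fun t : F =>
        ((i, !b, ⟨((1 - y * t) / x, t), hne _ (hd t)⟩) : Vtx F)) := by
      ext ⟨j, c, ⟨⟨s, t⟩, hw⟩⟩
      simp only [Set.mem_setOf_eq, Set.mem_range]
      constructor
      · rintro ⟨e1, e2, h3⟩
        refine ⟨t, Prod.ext e1.symm (Prod.ext e2.symm (Subtype.ext (Prod.ext ?_ rfl)))⟩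
        simp only [dot] at h3
        show (1 - y * t) / x = s
        rw [div_eq_iff hx]
        linear_combination -h3
      · rintro ⟨r, hr⟩
        rw [← hr]
        exact ⟨rfl, rfl, hd r⟩
    rw [this, ← Set.image_univ, Set.ncard_image_of_injective, Set.ncard_univ]
    intro s t h
    exact congrArg (fun x : Vtx F => x.2.2.1.2) h

/-- The explicit hexagon. -/
def hex : Fin 6 → Vtx F
  | 0 => (false, false, ⟨(1, 0), by simp⟩)
  | 1 => (false, true, ⟨(1, 1), by simp⟩)
  | 2 => (false, false, ⟨(0, 1), by simp⟩)
  | 3 => (false, true, ⟨(0, 1), by simp⟩)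
  | 4 => (false, false, ⟨(1, 1), by simp⟩)
  | 5 => (false, true, ⟨(1, 0), by simp⟩)

theorem hex_inj : Function.Injective (hex : Fin 6 → Vtx F) := by
  intro i j h
  fin_cases i <;> fin_cases j <;> first | rfl | (exfalso; simp [hex] at h)

theorem hex_edge (i : Fin 6) : Ed (hex i : Vtx F) (hex (i + 1)) := by
  fin_cases i <;> simp [hex, Ed, dot]

end MixedCage

open MixedCage in
theorem mixed_exists (F : Type) [Field F] [Fintype F] (h8 : 8 ≤ Nat.card F) :
    ∃ (V : Type) (_ : Fintype V) (E A : V → V → Prop),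
      IsZRSixMixedGraph (Nat.card F / 4) (Nat.card F) E A ∧
        Nat.card V = 4 * Nat.card F ^ 2 - 4 := by
  classical
  obtain ⟨g, hg⟩ := IsCyclic.exists_generator (α := Fˣ)
  have ho : orderOf g = Nat.card F - 1 := by
    rw [orderOf_eq_card_of_forall_mem_zpowers hg, Nat.card_units]
  set z := Nat.card F / 4 with hzdef
  have hz : 1 ≤ z := by omega
  have hN : ∀ n, 1 ≤ n → n + 2 ≤ 4 * z → g ^ n ≠ 1 := by
    intro n h1 h2 h3
    have := Nat.le_of_dvd h1 (orderOf_dvd_of_pow_eq_one h3)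
    omega
  refine ⟨Vtx F, inferInstance, Ed, Ar g z, ⟨⟨?_, ?_, ?_, ?_⟩, out_card hN, in_card hN,
    edge_card, ?_, ?_⟩, ?_⟩
  · rintro u v ⟨h1, h2, h3⟩
    exact ⟨h1.symm, by simp [h2], by rw [dot_comm]; exact h3⟩
  · rintro v ⟨-, h, -⟩
    revert h; cases v.2.1 <;> simp
  · rintro v ⟨h, -⟩
    revert h; cases v.1 <;> simp
  · rintro u v ⟨h1, -⟩
    refine ⟨fun h => ?_, fun h => ?_⟩
    · have := h.1
      rw [h1] at this
      revert this; cases u.1 <;> simp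
    · have := h.1
      rw [h1] at this
      revert this; cases u.1 <;> simp
  · exact Or.inr ⟨by norm_num, hex, hex_inj, fun i => Or.inl (hex_edge i)⟩
  · intro k hk
    by_contra hlt
    push Not at hlt
    rcases hk with ⟨-, u, v, -, h1, h2⟩ | ⟨h3, f, hf, hs⟩
    · exact no_AA hN hz h1 h2
    · interval_cases k
      · have p0 := parity (hs 0)
        have p1 := parity (hs 1)
        have p2 := parity (hs 2)
        rw [show (2 : ZMod 3) + 1 = 0 from by decide, show (2 : ZMod 3) = 1 + 1 from by decide,
          p1, show (1 : ZMod 3) = 0 + 1 from by decide, p0] at p2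
        revert p2
        cases (xor (f 0).1 (f 0).2.1) <;> simp
      · exact no_four hN hz (fun h => absurd (hf h) (by decide))
          (fun h => absurd (hf h) (by decide)) (hs 0) (hs 1) (hs 2) (hs 3)
      · have p0 := parity (hs 0)
        have p1 := parity (hs 1)
        have p2 := parity (hs 2)
        have p3 := parity (hs 3)
        have p4 := parity (hs 4)
        rw [show (0 : ZMod 5) + 1 = 1 from by decide] at p0
        rw [show (1 : ZMod 5) + 1 = 2 from by decide] at p1
        rw [show (2 : ZMod 5) + 1 = 3 from by decide] at p2
        rw [show (3 : ZMod 5) + 1 = 4 from by decide] at p3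
        rw [show (4 : ZMod 5) + 1 = 0 from by decide, p3, p2, p1, p0] at p4
        revert p4
        cases (xor (f 0).1 (f 0).2.1) <;> simp
  · have : Nat.card (NZ F) = Nat.card F ^ 2 - 1 := by
      rw [Nat.card_eq_fintype_card, Fintype.card_subtype_compl, Fintype.card_subtype_eq,
        Fintype.card_prod, Nat.card_eq_fintype_card, sq]
    rw [Nat.card_prod, Nat.card_prod, this]
    simp
    omega

/-- For every even prime power `q ≥ 8` there is a `[q/4, q; 6]`-mixed graph on
exactly `4q² − 4` vertices; hence `n[q/4, q; 6] ≤ 4q² − 4`. -/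
theorem mixed_cage_upper_bound_even (q : ℕ) (hq : IsPrimePow q) (hqe : Even q)
    (hq8 : 8 ≤ q) :
    ∃ (V : Type) (_ : Fintype V) (E A : V → V → Prop),
      IsZRSixMixedGraph (q / 4) q E A ∧ Nat.card V = 4 * q ^ 2 - 4 := by
  classical
  obtain ⟨p, k, hp, hk, rfl⟩ := hq
  haveI : Fact p.Prime := ⟨hp.nat_prime⟩
  have hc : Nat.card (GaloisField p k) = p ^ k := GaloisField.card p k hk.ne'
  haveI : Fintype (GaloisField p k) := Fintype.ofFinite _
  obtain ⟨V, h1, E, A, h2, h3⟩ := mixed_exists (GaloisField p k) (by rw [hc]; exact hq8)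
  rw [hc] at h2 h3
  exact ⟨V, h1, E, A, h2, h3⟩
end

section
/- For every odd prime power q ≥ 7 with q ≡ 3 (mod 4) there exists a mixed graph on exactly 4q² − 4 vertices which is a [(q−3)/4, q; 6]-mixed graph; that is, n[(q−3)/4, q; 6] ≤ 4q² − 4. -/
section MixedCage

/-- Vertices: nonzero vectors, with a point/line flag and a copy flag. -/
abbrev MCV (F : Type) [Field F] : Type := {v : F × F // v ≠ 0} × Bool × Bool

/-- Edges: incidence `x·y = 1` between a point and a line of the same copy. -/
def MCE (F : Type) [Field F] (u w : MCV F) : Prop :=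
  u.1.1.1 * w.1.1.1 + u.1.1.2 * w.1.1.2 = 1 ∧ w.2.1 = !u.2.1 ∧ w.2.2 = u.2.2

/-- Multiplier: `g` on points, `g⁻¹` on lines. -/
def MCh {F : Type} [Field F] (g : F) (t : Bool) : F := if t then g else g⁻¹

/-- Arcs: multiply by a small power of the multiplier and change copy. -/
def MCA (F : Type) [Field F] (g : F) (z : ℕ) (u w : MCV F) : Prop :=
  ∃ s : ℕ, 1 ≤ s ∧ s ≤ z ∧ w.1.1.1 = MCh g u.2.1 ^ s * u.1.1.1 ∧
    w.1.1.2 = MCh g u.2.1 ^ s * u.1.1.2 ∧ w.2.1 = u.2.1 ∧ w.2.2 = !u.2.2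

variable {F : Type} [Field F] {g : F} {z : ℕ}

lemma MCh_ne (hg : g ≠ 0) (t : Bool) : MCh g t ≠ 0 := by
  unfold MCh; split <;> simp [hg]

lemma MCh_not (hg : g ≠ 0) (t : Bool) : MCh g (!t) * MCh g t = 1 := by
  cases t <;> simp [MCh, hg]

lemma MCh_pow (ho : orderOf g = 4 * z + 2) (t : Bool) (n : ℕ) (h1 : 1 ≤ n) (h2 : n ≤ 4 * z) :
    MCh g t ^ n ≠ 1 := by
  intro h
  have h' : g ^ n = 1 := by
    cases t <;> simpa [MCh] using h
  have := Nat.le_of_dvd (by omega) (orderOf_dvd_of_pow_eq_one h')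
  omega

lemma MC_scale {c : F} {v : F × F} (hv : v ≠ 0) (h1 : v.1 = c * v.1) (h2 : v.2 = c * v.2) :
    c = 1 := by
  by_contra hc
  have hc' : c - 1 ≠ 0 := sub_ne_zero.mpr hc
  apply hv
  ext
  · have : (c - 1) * v.1 = 0 := by linear_combination -h1
    simpa [hc'] using this
  · have : (c - 1) * v.2 = 0 := by linear_combination -h2
    simpa [hc'] using this

lemma MC_two (ho : orderOf g = 4 * z + 2) (u v : MCV F)
    (h1 : MCA F g z u v) (h2 : MCA F g z v u) : False := by
  obtain ⟨s, s1, s2, a1, a2, a3, a4⟩ := h1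
  obtain ⟨r, r1, r2, b1, b2, b3, b4⟩ := h2
  rw [a3] at b1 b2
  refine MCh_pow ho u.2.1 (r + s) (by omega) (by omega) (MC_scale u.1.2 ?_ ?_)
  · rw [pow_add, mul_assoc, ← a1, ← b1]
  · rw [pow_add, mul_assoc, ← a2, ← b2]

lemma MC_four_A (ho : orderOf g = 4 * z + 2) (a b c d : MCV F)
    (h1 : MCA F g z a b) (h2 : MCA F g z b c) (h3 : MCA F g z c d) (h4 : MCA F g z d a) :
    False := by
  obtain ⟨s, s1, s2, a1, a2, a3, a4⟩ := h1
  obtain ⟨r, r1, r2, b1, b2, b3, b4⟩ := h2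
  obtain ⟨p, p1, p2, c1, c2, c3, c4⟩ := h3
  obtain ⟨o, o1, o2, d1, d2, d3, d4⟩ := h4
  rw [c3, b3, a3] at d1 d2
  rw [b3, a3] at c1 c2
  rw [a3] at b1 b2
  refine MCh_pow ho a.2.1 (o + p + r + s) (by omega) (by omega) (MC_scale a.1.2 ?_ ?_)
  · rw [pow_add, mul_assoc, ← a1, pow_add, mul_assoc, ← b1, pow_add, mul_assoc, ← c1, ← d1]
  · rw [pow_add, mul_assoc, ← a2, pow_add, mul_assoc, ← b2, pow_add, mul_assoc, ← c2, ← d2]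

lemma MC_AAEE (ho : orderOf g = 4 * z + 2) (a b c d : MCV F)
    (h1 : MCA F g z a b) (h2 : MCA F g z b c) (h3 : MCE F c d) (h4 : MCE F d a) :
    False := by
  obtain ⟨s, s1, s2, a1, a2, a3, a4⟩ := h1
  obtain ⟨r, r1, r2, b1, b2, b3, b4⟩ := h2
  obtain ⟨e1, -, -⟩ := h3
  obtain ⟨e2, -, -⟩ := h4
  rw [a3] at b1 b2
  refine MCh_pow ho a.2.1 (r + s) (by omega) (by omega) ?_
  rw [b1, b2, a1, a2] at e1
  rw [pow_add]
  linear_combination e1 - MCh g a.2.1 ^ r * MCh g a.2.1 ^ s * e2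

lemma MC_EAEA (hg : g ≠ 0) (ho : orderOf g = 4 * z + 2) (a b c d : MCV F)
    (h1 : MCE F a b) (h2 : MCA F g z b c) (h3 : MCE F c d) (h4 : MCA F g z d a) :
    False := by
  obtain ⟨e1, e2, -⟩ := h1
  obtain ⟨s, s1, s2, a1, a2, a3, a4⟩ := h2
  obtain ⟨f1, f2, -⟩ := h3
  obtain ⟨r, r1, r2, b1, b2, b3, b4⟩ := h4
  have ht : b.2.1 = !d.2.1 := by rw [e2, b3]
  rw [ht] at a1 a2
  refine MCh_pow ho d.2.1 (r + s) (by omega) (by omega) ?_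
  rw [a1, a2] at f1
  rw [b1, b2] at e1
  have k : MCh g (!d.2.1) ^ s * MCh g d.2.1 ^ s = 1 := by
    rw [← mul_pow, MCh_not hg, one_pow]
  rw [pow_add]
  linear_combination (-MCh g d.2.1 ^ r * MCh g d.2.1 ^ s) * f1 +
    (d.1.1.1 * b.1.1.1 + d.1.1.2 * b.1.1.2) * MCh g d.2.1 ^ r * k + e1

lemma MC_EEEE (a b c d : MCV F) (hac : a ≠ c) (hbd : b ≠ d)
    (h1 : MCE F a b) (h2 : MCE F b c) (h3 : MCE F c d) (h4 : MCE F d a) : False := by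
  obtain ⟨e1, e2, e3⟩ := h1
  obtain ⟨f1, f2, f3⟩ := h2
  obtain ⟨g1, g2, g3⟩ := h3
  obtain ⟨i1, i2, i3⟩ := h4
  have hD : b.1.1.1 * d.1.1.2 - b.1.1.2 * d.1.1.1 ≠ 0 := by
    intro h
    apply hbd
    refine Prod.ext (Subtype.ext (Prod.ext ?_ ?_)) (Prod.ext ?_ ?_)
    · linear_combination d.1.1.1 * e1 - b.1.1.1 * i1 + a.1.1.2 * h
    · linear_combination d.1.1.2 * e1 - b.1.1.2 * i1 - a.1.1.1 * h
    · rw [g2, f2, Bool.not_not]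
    · rw [g3, f3]
  apply hac
  refine Prod.ext (Subtype.ext (Prod.ext ?_ ?_)) (Prod.ext ?_ ?_)
  · apply mul_left_cancel₀ hD
    linear_combination d.1.1.2 * (e1 - f1) - b.1.1.2 * (i1 - g1)
  · apply mul_left_cancel₀ hD
    linear_combination -d.1.1.1 * (e1 - f1) + b.1.1.1 * (i1 - g1)
  · simp [f2, e2]
  · simp [f3, e3]

/-- Every step flips the sum of the two flags. -/
lemma MC_color (u w : MCV F) (h : MCE F u w ∨ MCA F g z u w) :
    (w.2.1 ^^ w.2.2) = !(u.2.1 ^^ u.2.2) := by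
  rcases h with ⟨-, h1, h2⟩ | ⟨-, -, -, -, -, h1, h2⟩
  · rw [h1, h2]; cases u.2.1 <;> cases u.2.2 <;> rfl
  · rw [h1, h2]; cases u.2.1 <;> cases u.2.2 <;> rfl

lemma MC_four (hg : g ≠ 0) (ho : orderOf g = 4 * z + 2) (a b c d : MCV F)
    (hac : a ≠ c) (hbd : b ≠ d)
    (h1 : MCE F a b ∨ MCA F g z a b) (h2 : MCE F b c ∨ MCA F g z b c)
    (h3 : MCE F c d ∨ MCA F g z c d) (h4 : MCE F d a ∨ MCA F g z d a) : False := by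
  have tE : ∀ {u w : MCV F}, MCE F u w → w.2.1 = (true ^^ u.2.1) := fun h => by rw [h.2.1]; simp
  have tA : ∀ {u w : MCV F}, MCA F g z u w → w.2.1 = (false ^^ u.2.1) := by
    rintro u w ⟨s, _, _, _, _, h, _⟩; rw [h]; simp
  have par : ∀ a b c d p q r s : Bool, b = (p ^^ a) → c = (q ^^ b) → d = (r ^^ c) →
      a = (s ^^ d) → (p ^^ q ^^ r ^^ s) = true → False := by decide
  rcases h1 with h1 | h1 <;> rcases h2 with h2 | h2 <;> rcases h3 with h3 | h3 <;>
    rcases h4 with h4 | h4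
  · exact MC_EEEE a b c d hac hbd h1 h2 h3 h4
  · exact par _ _ _ _ _ _ _ _ (tE h1) (tE h2) (tE h3) (tA h4) (by decide)
  · exact par _ _ _ _ _ _ _ _ (tE h1) (tE h2) (tA h3) (tE h4) (by decide)
  · exact MC_AAEE ho c d a b h3 h4 h1 h2
  · exact par _ _ _ _ _ _ _ _ (tE h1) (tA h2) (tE h3) (tE h4) (by decide)
  · exact MC_EAEA hg ho a b c d h1 h2 h3 h4
  · exact MC_AAEE ho b c d a h2 h3 h4 h1
  · exact par _ _ _ _ _ _ _ _ (tE h1) (tA h2) (tA h3) (tA h4) (by decide)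
  · exact par _ _ _ _ _ _ _ _ (tA h1) (tE h2) (tE h3) (tE h4) (by decide)
  · exact MC_AAEE ho d a b c h4 h1 h2 h3
  · exact MC_EAEA hg ho b c d a h2 h3 h4 h1
  · exact par _ _ _ _ _ _ _ _ (tA h1) (tE h2) (tA h3) (tA h4) (by decide)
  · exact MC_AAEE ho a b c d h1 h2 h3 h4
  · exact par _ _ _ _ _ _ _ _ (tA h1) (tA h2) (tE h3) (tA h4) (by decide)
  · exact par _ _ _ _ _ _ _ _ (tA h1) (tA h2) (tA h3) (tE h4) (by decide)
  · exact MC_four_A ho a b c d h1 h2 h3 h4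

lemma MC_count (hg : g ≠ 0) (ho : orderOf g = 4 * z + 2) (v : MCV F) (t : Bool) :
    {w : MCV F | ∃ s : ℕ, 1 ≤ s ∧ s ≤ z ∧ w.1.1.1 = MCh g t ^ s * v.1.1.1 ∧
      w.1.1.2 = MCh g t ^ s * v.1.1.2 ∧ w.2.1 = v.2.1 ∧ w.2.2 = !v.2.2}.ncard = z := by
  have hh := MCh_ne hg t
  have hv := v.1.2
  let φ : ℕ → MCV F := fun s =>
    (⟨(MCh g t ^ s * v.1.1.1, MCh g t ^ s * v.1.1.2), by
      intro h
      apply hv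
      simp only [Prod.mk_eq_zero, mul_eq_zero, pow_eq_zero_iff', hh, false_and, false_or] at h
      exact Prod.ext h.1 h.2⟩, v.2.1, !v.2.2)
  have key : ∀ s r : ℕ, 1 ≤ s → s < r → r ≤ z → φ s ≠ φ r := by
    intro s r hs hsr hr h
    have e1 := congrArg (fun w : MCV F => w.1.1.1) h
    have e2 := congrArg (fun w : MCV F => w.1.1.2) h
    simp only [φ] at e1 e2
    refine MCh_pow ho t (r - s) (by omega) (by omega) (MC_scale hv ?_ ?_)
    · apply mul_left_cancel₀ (pow_ne_zero s hh)
      rw [e1, ← mul_assoc, ← pow_add]; congr 2; omega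
    · apply mul_left_cancel₀ (pow_ne_zero s hh)
      rw [e2, ← mul_assoc, ← pow_add]; congr 2; omega
  have himg : {w : MCV F | ∃ s : ℕ, 1 ≤ s ∧ s ≤ z ∧ w.1.1.1 = MCh g t ^ s * v.1.1.1 ∧
      w.1.1.2 = MCh g t ^ s * v.1.1.2 ∧ w.2.1 = v.2.1 ∧ w.2.2 = !v.2.2}
      = φ '' (↑(Finset.Icc 1 z) : Set ℕ) := by
    ext w
    simp only [Set.mem_ofPred_eq, Set.mem_image, Finset.coe_Icc, Set.mem_Icc]
    constructor
    · rintro ⟨s, h1, h2, h3, h4, h5, h6⟩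
      exact ⟨s, ⟨h1, h2⟩, Prod.ext (Subtype.ext (Prod.ext h3.symm h4.symm))
        (Prod.ext h5.symm h6.symm)⟩
    · rintro ⟨s, ⟨h1, h2⟩, rfl⟩
      exact ⟨s, h1, h2, rfl, rfl, rfl, rfl⟩
  rw [himg, Set.InjOn.ncard_image, Set.ncard_coe_finset, Nat.card_Icc]
  · omega
  · intro s hs r hr h
    simp only [Finset.coe_Icc, Set.mem_Icc] at hs hr
    rcases lt_trichotomy s r with h' | h' | h'
    · exact absurd h (key s r hs.1 h' hr.2)
    · exact h'
    · exact absurd h.symm (key r s hr.1 h' hs.2)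

lemma MC_in (hg : g ≠ 0) (v : MCV F) :
    {w | MCA F g z w v} = {w : MCV F | ∃ s : ℕ, 1 ≤ s ∧ s ≤ z ∧
      w.1.1.1 = MCh g (!v.2.1) ^ s * v.1.1.1 ∧
      w.1.1.2 = MCh g (!v.2.1) ^ s * v.1.1.2 ∧ w.2.1 = v.2.1 ∧ w.2.2 = !v.2.2} := by
  have k : ∀ s, MCh g (!v.2.1) ^ s * MCh g v.2.1 ^ s = 1 := fun s => by
    rw [← mul_pow, MCh_not hg, one_pow]
  ext w
  simp only [Set.mem_ofPred_eq, MCA]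
  constructor
  · rintro ⟨s, h1, h2, h3, h4, h5, h6⟩
    refine ⟨s, h1, h2, ?_, ?_, h5.symm, by simp [h6]⟩
    · rw [← h5] at h3; rw [h3, ← mul_assoc, k, one_mul]
    · rw [← h5] at h4; rw [h4, ← mul_assoc, k, one_mul]
  · rintro ⟨s, h1, h2, h3, h4, h5, h6⟩
    refine ⟨s, h1, h2, ?_, ?_, h5.symm, by simp [h6]⟩
    · rw [h5, h3, ← mul_assoc, mul_comm (_ ^ s), k, one_mul]
    · rw [h5, h4, ← mul_assoc, mul_comm (_ ^ s), k, one_mul]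

lemma MC_deg (v : MCV F) : {w | MCE F v w}.ncard = Nat.card F := by
  obtain ⟨⟨⟨x, y⟩, hv⟩, t, c⟩ := v
  obtain ⟨a, b, hab⟩ : ∃ a b : F, x * a + y * b = 1 := by
    by_cases hx : x = 0
    · have hy : y ≠ 0 := by
        rintro rfl; exact hv (by rw [hx]; rfl)
      exact ⟨0, y⁻¹, by simp [hy]⟩
    · exact ⟨x⁻¹, 0, by simp [hx]⟩
  have hn : ∀ r : F, ((a - y * r, b + x * r) : F × F) ≠ 0 := by
    intro r h
    rw [Prod.mk_eq_zero] at h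
    apply one_ne_zero (α := F)
    linear_combination -hab + x * h.1 + y * h.2
  let φ : F → MCV F := fun r => (⟨(a - y * r, b + x * r), hn r⟩, !t, c)
  have himg : {w | MCE F (⟨(x, y), hv⟩, t, c) w} = Set.range φ := by
    ext ⟨⟨⟨p, q⟩, hw⟩, t', c'⟩
    simp only [Set.mem_ofPred_eq, MCE, Set.mem_range, φ, Prod.mk.injEq, Subtype.mk.injEq]
    constructor
    · rintro ⟨h1, h2, h3⟩
      refine ⟨a * q - b * p, ⟨?_, ?_⟩, h2.symm, h3.symm⟩
      · linear_combination p * hab - a * h1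
      · linear_combination q * hab - b * h1
    · rintro ⟨r, ⟨h1, h2⟩, h3, h4⟩
      refine ⟨?_, h3.symm, h4.symm⟩
      rw [← h1, ← h2]; linear_combination hab
  have hinj : Function.Injective φ := by
    intro r s h
    simp only [φ, Prod.mk.injEq, Subtype.mk.injEq, and_true] at h
    linear_combination (s - r) * hab + a * h.2 - b * h.1
  rw [himg, ← Nat.card_coe_set_eq, Nat.card_range_of_injective hinj]

lemma MC_six : HasMixedCycle (MCE F) (MCA F g z) 6 := by
  right
  refine ⟨by norm_num, ?_⟩
  let f : Fin 6 → MCV F := ![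
    (⟨(1, 0), by simp⟩, true, true), (⟨(1, 1), by simp⟩, false, true),
    (⟨(0, 1), by simp⟩, true, true), (⟨(2, 1), by simp⟩, false, true),
    (⟨(1, -1), by simp⟩, true, true), (⟨(1, 0), by simp⟩, false, true)]
  have h21 : (2 : F) ≠ 1 := by
    intro h
    apply one_ne_zero (α := F)
    linear_combination h
  refine ⟨f, ?_, ?_⟩
  · change Function.Injective f
    intro i j
    fin_cases i <;> fin_cases j <;> simp [f, h21, h21.symm]
  · intro i
    left
    change Fin 6 at i
    change MCE F (f i) (f (i + 1))
    fin_cases i <;> simp [f, MCE] <;> norm_num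

end MixedCage

theorem mixed_cage_upper_bound_three_mod_four (q : ℕ) (hq : IsPrimePow q)
    (hqo : Odd q) (hq3 : q % 4 = 3) (hq7 : 7 ≤ q) :
    ∃ (V : Type) (_ : Fintype V) (E A : V → V → Prop),
      IsZRSixMixedGraph ((q - 3) / 4) q E A ∧ Nat.card V = 4 * q ^ 2 - 4 := by
  classical
  obtain ⟨p, n, hp, hn, hpn⟩ := (isPrimePow_nat_iff q).1 hq
  have : Fact p.Prime := ⟨hp⟩
  let F := GaloisField p n
  have : Finite F := inferInstanceAs (Finite (GaloisField p n))
  letI : Fintype F := Fintype.ofFinite F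
  have hF : Nat.card F = q := by rw [GaloisField.card p n hn.ne', hpn]
  obtain ⟨u, hu⟩ := IsCyclic.exists_generator (α := Fˣ)
  have hou : orderOf (u : F) = 4 * ((q - 3) / 4) + 2 := by
    rw [orderOf_units, orderOf_eq_card_of_forall_mem_zpowers hu, Nat.card_units, hF]
    omega
  have hg : (u : F) ≠ 0 := u.ne_zero
  generalize hz : (q - 3) / 4 = z at *
  refine ⟨MCV F, inferInstance, MCE F, MCA F (u : F) z, ⟨⟨?_, ?_, ?_, ?_⟩, ?_, ?_, ?_, ?_, ?_⟩, ?_⟩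
  · rintro a b ⟨h1, h2, h3⟩
    exact ⟨by linear_combination h1, by simp [h2], h3.symm⟩
  · rintro a ⟨h1, h2, h3⟩
    simp at h2
  · rintro a ⟨s, _, _, _, _, _, h⟩
    simp at h
  · rintro a b ⟨h1, h2, h3⟩
    constructor
    · rintro ⟨s, _, _, _, _, h, _⟩
      simp [h2] at h
    · rintro ⟨s, _, _, _, _, h, _⟩
      simp [h2] at h
  · intro v
    exact MC_count hg hou v v.2.1
  · intro v
    rw [MC_in hg]
    exact MC_count hg hou v (!v.2.1)
  · intro v
    rw [MC_deg, hF]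
  · exact MC_six
  · rintro k (⟨rfl, a, b, -, h1, h2⟩ | ⟨hk, f, hf, hs⟩)
    · exact (MC_two hou a b h1 h2).elim
    · by_contra hlt
      push Not at hlt
      interval_cases k
      · have h0 := MC_color _ _ (hs 0)
        have h1 := MC_color _ _ (hs 1)
        have h2 := MC_color _ _ (hs 2)
        have e1 : (0 + 1 : ZMod 3) = 1 := rfl
        have e2 : (1 + 1 : ZMod 3) = 2 := rfl
        have e3 : (2 + 1 : ZMod 3) = 0 := rfl
        rw [e1] at h0; rw [e2] at h1; rw [e3] at h2
        rw [h1, h0] at h2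
        simp at h2
      · have e1 : (0 + 1 : ZMod 4) = 1 := rfl
        have e2 : (1 + 1 : ZMod 4) = 2 := rfl
        have e3 : (2 + 1 : ZMod 4) = 3 := rfl
        have e4 : (3 + 1 : ZMod 4) = 0 := rfl
        have h0 := hs 0
        have h1 := hs 1
        have h2 := hs 2
        have h3 := hs 3
        rw [e1] at h0; rw [e2] at h1; rw [e3] at h2; rw [e4] at h3
        refine MC_four hg hou (f 0) (f 1) (f 2) (f 3) ?_ ?_ h0 h1 h2 h3
        · exact hf.ne (by decide)
        · exact hf.ne (by decide)
      · have h0 := MC_color _ _ (hs 0)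
        have h1 := MC_color _ _ (hs 1)
        have h2 := MC_color _ _ (hs 2)
        have h3 := MC_color _ _ (hs 3)
        have h4 := MC_color _ _ (hs 4)
        have e1 : (0 + 1 : ZMod 5) = 1 := rfl
        have e2 : (1 + 1 : ZMod 5) = 2 := rfl
        have e3 : (2 + 1 : ZMod 5) = 3 := rfl
        have e4 : (3 + 1 : ZMod 5) = 4 := rfl
        have e5 : (4 + 1 : ZMod 5) = 0 := rfl
        rw [e1] at h0; rw [e2] at h1; rw [e3] at h2; rw [e4] at h3; rw [e5] at h4
        rw [h3, h2, h1, h0] at h4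
        simp at h4
  · have hc : Nat.card {v : F × F // v ≠ 0} = q ^ 2 - 1 := by
      rw [Nat.card_eq_fintype_card, Fintype.card_subtype_compl, Fintype.card_subtype_eq,
        Fintype.card_prod, ← Nat.card_eq_fintype_card, hF, sq]
    rw [Nat.card_prod, Nat.card_prod, hc, Nat.card_eq_fintype_card, Fintype.card_bool]
    omega
end

section
/- For every odd natural number p ≥ 1, with n = 4p + 2 and S the set of odd integers s with 1 ≤ s ≤ p, there exists a function f : Fin 6 → ℕ with f i ∈ S for all i and ∑ i, f i = n; moreover, for every k with 1 ≤ k ≤ 5 and every f : Fin k → ℕ with f i ∈ S for all i, the sum ∑ i, f i is not divisible by n. (Explicitly, four jumps of length p together with two jumps of length 1 sum to 4p + 2 = n.) -/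
/-- Arithmetic content of the directed girth computation: for odd `p ≥ 1`, with
`n = 4p+2` and jumps the odd integers in `[1,p]`, there is a 6-tuple of jumps summing
to exactly `n`, while no `k`-tuple of jumps with `1 ≤ k ≤ 5` has sum divisible by `n`. -/
theorem circulant_girth_six_arithmetic (p : ℕ) (hp : Odd p) (hp1 : 1 ≤ p) :
    (∃ f : Fin 6 → ℕ,
      (∀ i, Odd (f i) ∧ 1 ≤ f i ∧ f i ≤ p) ∧ ∑ i, f i = 4 * p + 2) ∧
    (∀ k : ℕ, 1 ≤ k → k ≤ 5 → ∀ f : Fin k → ℕ,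
      (∀ i, Odd (f i) ∧ 1 ≤ f i ∧ f i ≤ p) → ¬ (4 * p + 2) ∣ ∑ i, f i) := by
  constructor
  · refine ⟨![p, p, p, p, 1, 1], ?_, ?_⟩
    · intro i
      fin_cases i <;> simp [hp, hp1]
    · simp [Fin.sum_univ_succ]
      ring
  · intro k hk1 hk5 f hf hdvd
    have h2 : 2 ∣ ∑ i, f i := dvd_trans ⟨2 * p + 1, by ring⟩ hdvd
    have hpos : 0 < ∑ i, f i :=
      Finset.sum_pos (fun i _ => (hf i).2.1) ⟨⟨0, hk1⟩, Finset.mem_univ _⟩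
    have hle := Nat.le_of_dvd hpos hdvd
    have hub : ∑ i, f i ≤ k * p := by
      simpa using Finset.sum_le_card_nsmul Finset.univ f p (fun i _ => (hf i).2.2)
    have hk : k = 5 := by
      by_contra hne
      have : k * p ≤ 4 * p := Nat.mul_le_mul_right p (by omega)
      omega
    subst hk
    have hodd := fun i => Nat.odd_iff.mp (hf i).1
    have h0 := hodd 0
    have h1 := hodd 1
    have h2' := hodd 2
    have h3 := hodd 3
    have h4 := hodd 4
    rw [Fin.sum_univ_five] at h2
    omega
end
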